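/- Let (X,𝒦) be a finite connectivity space (X a finite set) and A ∈ 𝒦. A sieve σ on A in the poset category (𝒦,⊆) satisfies [σ̇] = 𝒦 ∩ 𝒫(A) (i.e. σ is a covering sieve for the Grothendieck topology of the space) if and only if σ̇ contains every irreducible connected set K ∈ 𝒦 with K ⊆ A. -/

import Mathlib

open CategoryTheory

/-- A connectivity structure on `X`: contains `∅`, and is stable under unions of
families with nonempty intersection. -/
def IsConnStruct {X : Type} (K : Set (Set X)) : Prop :=
  ∅ ∈ K ∧ ∀ S : Set (Set X), S ⊆ K → (⋂₀ S).Nonempty → ⋃₀ S ∈ K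

/-- The connectivity structure generated by a collection `C` of subsets of `X`. -/
def genConn {X : Type} (C : Set (Set X)) : Set (Set X) :=
  ⋂₀ {L | IsConnStruct L ∧ C ⊆ L}

/-- The set `σ̇` of elements of a sieve `σ` on `A` in the poset category `𝒦`. -/
def sieveSet {X : Type} {K : Set (Set X)} {A : ↥K} (σ : Sieve A) : Set (Set X) :=
  {B | ∃ (hB : B ∈ K) (hle : (⟨B, hB⟩ : ↥K) ≤ A), σ.arrows (homOfLE hle)}

theorem genConn_isConn {X : Type} (C : Set (Set X)) : IsConnStruct (genConn C) := by
  refine ⟨?_, ?_⟩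
  · intro L hL
    exact hL.1.1
  · intro S hS hn L hL
    exact hL.1.2 S (fun s hs => hS hs L hL) hn

theorem genConn_min {X : Type} {C L : Set (Set X)} (hL : IsConnStruct L) (h : C ⊆ L) :
    genConn C ⊆ L := fun _ hB => hB L ⟨hL, h⟩

theorem subset_genConn {X : Type} (C : Set (Set X)) : C ⊆ genConn C :=
  fun _ hB _ hL => hL.2 hB

theorem stmt8 {X : Type} [Finite X] (K : Set (Set X)) (hK : IsConnStruct K)
    (A : ↥K) (σ : Sieve A) :
    genConn (sieveSet σ) = K ∩ Set.powerset A.1 ↔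
      ∀ B ∈ K, B ∉ genConn (K \ {B}) → B ⊆ A.1 → B ∈ sieveSet σ := by
  have hsub : sieveSet σ ⊆ K ∩ Set.powerset A.1 := by
    rintro B ⟨hB, hle, _⟩
    exact ⟨hB, hle⟩
  constructor
  · intro h B hB hirr hBA
    by_contra hn
    have h1 : B ∈ genConn (sieveSet σ) := by
      rw [h]
      exact ⟨hB, hBA⟩
    apply hirr
    refine genConn_min (genConn_isConn _) ?_ h1
    intro C hC
    refine subset_genConn _ ⟨(hsub hC).1, ?_⟩
    rintro rfl
    exact hn hC
  · intro h
    apply Set.Subset.antisymm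
    · refine genConn_min ⟨⟨hK.1, Set.empty_subset _⟩, ?_⟩ hsub
      intro S hS hn
      exact ⟨hK.2 S (fun s hs => (hS hs).1) hn, Set.sUnion_subset fun s hs => (hS hs).2⟩
    · rintro B ⟨hB, hBA⟩
      induction B using (wellFounded_lt (α := Set X)).induction with
      | _ B ih =>
      by_cases hirr : B ∈ genConn (K \ {B})
      · have key : genConn (K \ {B}) ⊆ {C | C ⊆ B → C ∈ genConn (sieveSet σ)} := by
          refine genConn_min ⟨fun _ => (genConn_isConn _).1, ?_⟩ ?_
          · intro S hS hn hu
            exact (genConn_isConn _).2 S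
              (fun s hs => hS hs ((Set.subset_sUnion_of_mem hs).trans hu)) hn
          · rintro C ⟨hC, hne⟩ hCB
            exact ih C (lt_of_le_of_ne hCB hne) hC (hCB.trans hBA)
        exact key hirr subset_rfl
      · exact subset_genConn _ (h B hB hirr hBA)
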